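/- arXiv:2003.00727 — 4 statements merged into one kernel-verified Lean document; each statement's English description precedes it below -/
import Mathlib

section
/- Let Z be a Brown–Resnick stationary random field with values in E satisfying E[Z(t)] = 1 for all t ∈ ℤ^d and max_{t∈ℤ^d} Z(t) > 0 almost surely, and let Θ be its spectral tail field. Let x = (x_j)_{j∈ℤ^d} with x_j ∈ (0,∞] for all j and x_j < ∞ for only finitely many j (at least one). Then E[max_{t∈ℤ^d} Z(t)/x_t] = Σ_{j∈ℤ^d, x_j < ∞} x_j^{−1} · P( I_fm( Θ/(B^{−j}x) ) = 0 ), where Θ/(B^{−j}x) denotes the field (Θ(t)/x_{t+j})_{t∈ℤ^d} and a/∞ := 0. -/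
open MeasureTheory ENNReal Filter
open scoped NNReal ENNReal

/-- Index set `ℤ^d`. -/
abbrev Idx (d : ℕ) := Fin d → ℤ

/-- The space `E = [0,∞)^{ℤ^d}` (with the product σ-field). -/
abbrev Fld (d : ℕ) := Idx d → ℝ≥0

/-- The shift `B^h`, acting by `(B^h f)(t) = f (t - h)`. -/
def shift {d : ℕ} (h : Idx d) (f : Fld d) : Fld d := fun t => f (t - h)

/-- `F : E → [0,∞]` is 0-homogeneous if `F (c • f) = F f` for all `c > 0`. -/
def Homog0 {d : ℕ} (F : Fld d → ℝ≥0∞) : Prop :=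
  ∀ c : ℝ≥0, 0 < c → ∀ f : Fld d, F (fun t => c * f t) = F f

/-- `Z` is a Brown–Resnick stationary random field with unit means: it is measurable,
`E[Z(t)] = 1` for all `t`, and `E[Z(h) F(Z)] = E[Z(0) F(B^h Z)]` for every measurable
0-homogeneous `F : E → [0,∞]`. -/
structure IsBRS {d : ℕ} {Ω : Type*} [MeasurableSpace Ω] (P : Measure Ω)
    (Z : Ω → Fld d) : Prop where
  meas : Measurable Z
  mean_one : ∀ t : Idx d, ∫⁻ ω, (Z ω t : ℝ≥0∞) ∂P = 1
  tilt_shift : ∀ (h : Idx d) (F : Fld d → ℝ≥0∞), Measurable F → Homog0 F →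
    ∫⁻ ω, (Z ω h : ℝ≥0∞) * F (Z ω) ∂P = ∫⁻ ω, (Z ω 0 : ℝ≥0∞) * F (shift h (Z ω)) ∂P

/-- The discrete cube `{0,1,…,n}^d ⊆ ℤ^d`. -/
def cube (d n : ℕ) : Set (Idx d) := {t | ∀ j, 0 ≤ t j ∧ t j ≤ (n : ℤ)}

/-- `E[max_{t ∈ {0,…,n}^d} Z(t)]`. -/
noncomputable def cubeMaxExp {d : ℕ} {Ω : Type*} [MeasurableSpace Ω] (P : Measure Ω)
    (Z : Ω → Fld d) (n : ℕ) : ℝ≥0∞ :=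
  ∫⁻ ω, ⨆ t ∈ cube d n, (Z ω t : ℝ≥0∞) ∂P

/-- The spectral tail field: `Θ` (on a possibly different probability space `Q`) has law
`P(Θ ∈ A) = E[Z(0)·1{Z/Z(0) ∈ A}]` (the integrand vanishing on `{Z(0) = 0}`). -/
def IsSpectralTail {d : ℕ} {Ω Ω' : Type*} [MeasurableSpace Ω] [MeasurableSpace Ω']
    (P : Measure Ω) (Z : Ω → Fld d) (Q : Measure Ω') (Θ : Ω' → Fld d) : Prop :=
  Measurable Θ ∧ ∀ A : Set (Fld d), MeasurableSet A →
    Q (Θ ⁻¹' A) =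
      ∫⁻ ω, (Z ω 0 : ℝ≥0∞) *
        A.indicator (fun _ => (1 : ℝ≥0∞)) (fun t => Z ω t / Z ω 0) ∂P

/-- Lexicographic order on `ℤ^d`. -/
def lexLe {d : ℕ} (a b : Idx d) : Prop :=
  a = b ∨ ∃ j, (∀ k, k < j → a k = b k) ∧ a j < b j

/-- `I_fm(g) = 0` for a `[0,∞]`-valued field `g`: `g` lies in the domain
`{S(g) < ∞, max_t g(t) > 0}` and `0` is the first (lexicographic) maximizer of `g`. -/
def FirstMaxAtZeroE {d : ℕ} (g : Idx d → ℝ≥0∞) : Prop :=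
  (∑' t : Idx d, g t) < ∞ ∧ (∃ t, 0 < g t) ∧
  (∀ t, g t ≤ g 0) ∧ ∀ j, (∀ t, g t ≤ g j) → lexLe 0 j


theorem aux_lexLe_iff {d : ℕ} (a b : Idx d) : lexLe a b ↔ toLex a ≤ toLex b := by
  rw [le_iff_eq_or_lt, lexLe]
  refine or_congr ?_ ?_
  · exact (toLex_inj).symm
  · exact Iff.rfl

theorem aux_lexLe_shift {d : ℕ} (a b : Idx d) : lexLe 0 (b - a) ↔ lexLe a b := by
  unfold lexLe
  refine or_congr ?_ ?_
  · rw [eq_comm, sub_eq_zero, eq_comm]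
  · refine exists_congr fun j => and_congr (forall_congr' fun k => imp_congr Iff.rfl ?_) ?_
    · simp only [Pi.zero_apply, Pi.sub_apply]; omega
    · simp only [Pi.zero_apply, Pi.sub_apply]; omega

theorem aux_fm {d : ℕ} (g : Idx d → ℝ≥0∞) (j : Idx d)
    (h : FirstMaxAtZeroE (fun t => g (t + j))) :
    (∀ t, g t ≤ g j) ∧ ∀ k, (∀ t, g t ≤ g k) → toLex j ≤ toLex k := by
  obtain ⟨-, -, h1, h2⟩ := h
  refine ⟨fun t => by simpa using h1 (t - j), fun k hk => ?_⟩
  rw [← aux_lexLe_iff, ← aux_lexLe_shift]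
  exact h2 (k - j) (fun t => by simpa using hk (t + j))

open Classical in
theorem aux_pointwise {d : ℕ} (g : Idx d → ℝ≥0∞) (hg : ∀ t, g t ≠ ∞)
    (hs : (Function.support g).Finite) :
    ⨆ t, g t = ∑' j, g j * (if FirstMaxAtZeroE (fun t => g (t + j)) then 1 else 0) := by
  by_cases h0 : ∀ t, g t = 0
  · simp [h0]
  push Not at h0
  obtain ⟨t0, ht0⟩ := h0
  obtain ⟨m, hm, hmax⟩ := Set.exists_max_image (Function.support g) g hs ⟨t0, ht0⟩
  have hmax' : ∀ t, g t ≤ g m := fun t => by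
    by_cases ht : g t = 0
    · simp [ht]
    · exact hmax t ht
  have hpos : 0 < g m := pos_iff_ne_zero.2 hm
  have hMf : {k | ∀ t, g t ≤ g k}.Finite :=
    hs.subset fun k hk => (lt_of_lt_of_le hpos (hk m)).ne'
  obtain ⟨j, hj, hjmin⟩ := Set.exists_min_image _ (fun k : Idx d => toLex k) hMf ⟨m, hmax'⟩
  have hFM : FirstMaxAtZeroE (fun t => g (t + j)) := by
    refine ⟨?_, ⟨0, ?_⟩, ?_, ?_⟩
    · have : ∑' t, g (t + j) = ∑' t, g t := (Equiv.addRight j).tsum_eq g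
      rw [this, tsum_eq_sum (s := hs.toFinset) (by simp)]
      exact ENNReal.sum_lt_top.2 fun t _ => (hg t).lt_top
    · simpa using lt_of_lt_of_le hpos (hj m)
    · intro t; simpa using hj (t + j)
    · intro k hk
      have := hjmin (k + j) (fun t => by simpa using hk (t - j))
      rw [← aux_lexLe_iff, ← aux_lexLe_shift] at this
      simpa using this
  rw [tsum_eq_single j]
  · rw [if_pos hFM, mul_one]
    exact le_antisymm (iSup_le hj) (le_iSup g j)
  · intro k hk
    rw [if_neg, mul_zero]
    intro hF
    obtain ⟨h1, h2⟩ := aux_fm g k hF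
    exact hk (toLex_inj.1 (le_antisymm (h2 j hj) (hjmin k h1)))

theorem aux_meas {d : ℕ} : MeasurableSet {g : Idx d → ℝ≥0∞ | FirstMaxAtZeroE g} := by
  unfold FirstMaxAtZeroE
  have e : ∀ t : Idx d, Measurable fun g : Idx d → ℝ≥0∞ => g t := fun t => measurable_pi_apply t
  refine (measurableSet_lt (Measurable.ennreal_tsum e) measurable_const).inter
    (MeasurableSet.inter ?_ (MeasurableSet.inter ?_ ?_))
  · have : {g : Idx d → ℝ≥0∞ | ∃ t, 0 < g t} = ⋃ t, {g | 0 < g t} := by ext; simp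
    refine MeasurableSet.congr (s := _) ?_ this.symm
    exact MeasurableSet.iUnion fun t => measurableSet_lt measurable_const (e t)
  · have : {g : Idx d → ℝ≥0∞ | ∀ t, g t ≤ g 0} = ⋂ t, {g | g t ≤ g 0} := by ext; simp
    refine MeasurableSet.congr (s := _) ?_ this.symm
    exact MeasurableSet.iInter fun t => measurableSet_le (e t) (e 0)
  · have : {g : Idx d → ℝ≥0∞ | ∀ j, (∀ t, g t ≤ g j) → lexLe 0 j}
        = ⋂ j, ((⋂ t, {g | g t ≤ g j})ᶜ ∪ {_g | lexLe 0 j}) := by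
      ext g; simp [imp_iff_not_or]
    refine MeasurableSet.congr (s := _) ?_ this.symm
    exact MeasurableSet.iInter fun j =>
      ((MeasurableSet.iInter fun t => measurableSet_le (e t) (e j)).compl).union
        (MeasurableSet.const _)

theorem aux_scale {d : ℕ} (c : ℝ≥0∞) (hc : c ≠ 0) (hc' : c ≠ ∞) (g : Idx d → ℝ≥0∞) :
    FirstMaxAtZeroE (fun t => c * g t) ↔ FirstMaxAtZeroE g := by
  unfold FirstMaxAtZeroE
  simp only [ENNReal.tsum_mul_left, ENNReal.mul_le_mul_iff_right hc hc']
  refine and_congr ?_ (and_congr ?_ Iff.rfl)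
  · rw [ENNReal.mul_lt_top_iff]
    constructor
    · rintro (h | h | h)
      · exact h.2
      · exact absurd h hc
      · simp [h]
    · intro h; exact Or.inl ⟨hc'.lt_top, h⟩
  · simp [hc, pos_iff_ne_zero]

/-- Let `Z` be Brown–Resnick stationary with `E[Z(t)] = 1` and
`max_t Z(t) > 0` a.s., with spectral tail field `Θ`.  For `x = (x_j)` with
`x_j ∈ (0,∞]`, finitely many (at least one) `x_j < ∞`, one has
`E[max_t Z(t)/x_t] = Σ_j x_j⁻¹ P(I_fm(Θ/(B^{-j}x)) = 0)` where
`Θ/(B^{-j}x) = (Θ(t)/x_{t+j})_t` and `a/∞ = 0`. -/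
theorem stmt16 {d : ℕ} (hd : 0 < d) {Ω Ω' : Type*} [MeasurableSpace Ω] [MeasurableSpace Ω']
    (P : Measure Ω) [IsProbabilityMeasure P] (Q : Measure Ω') [IsProbabilityMeasure Q]
    (Z : Ω → Fld d) (hZ : IsBRS P Z) (hZpos : ∀ᵐ ω ∂P, ∃ t, 0 < Z ω t)
    (Θ : Ω' → Fld d) (hΘ : IsSpectralTail P Z Q Θ)
    (x : Idx d → ℝ≥0∞) (hxpos : ∀ j, 0 < x j)
    (hfin : {j | x j ≠ ∞}.Finite) (hne : {j | x j ≠ ∞}.Nonempty) :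
    ∫⁻ ω, ⨆ t : Idx d, (Z ω t : ℝ≥0∞) / x t ∂P =
      ∑' j : Idx d,
        (x j)⁻¹ * Q {ω | FirstMaxAtZeroE (fun t => (Θ ω t : ℝ≥0∞) / x (t + j))} := by
  classical
  have hZt : ∀ t, Measurable fun ω => (Z ω t : ℝ≥0∞) := fun t =>
    ((measurable_pi_apply t).comp hZ.meas).coe_nnreal_ennreal
  -- the event for a field
  let A : Idx d → Set (Fld d) := fun j => {f | FirstMaxAtZeroE (fun t => (f t : ℝ≥0∞) / x (t + j))}
  have hA : ∀ j, MeasurableSet (A j) := fun j => by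
    have : Measurable fun (f : Fld d) (t : Idx d) => (f t : ℝ≥0∞) / x (t + j) :=
      measurable_pi_lambda _ fun t => (measurable_pi_apply t).coe_nnreal_ennreal.div_const _
    exact this aux_meas
  have hAs : ∀ j (c : ℝ≥0), 0 < c → ∀ f : Fld d, (fun t => c * f t) ∈ A j ↔ f ∈ A j := by
    intro j c hc f
    have := aux_scale (c : ℝ≥0∞) (by exact_mod_cast hc.ne') ENNReal.coe_ne_top
      (fun t => (f t : ℝ≥0∞) / x (t + j))
    simp only [A, Set.mem_setOf_eq, ENNReal.coe_mul, mul_div_assoc]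
    exact this
  have hsh : ∀ j, Measurable fun f : Fld d => (shift (-j) f) := fun j =>
    measurable_pi_lambda _ fun t => measurable_pi_apply _
  let F : Idx d → Fld d → ℝ≥0∞ := fun j f => (A j).indicator (fun _ => 1) (shift (-j) f)
  have hF : ∀ j, Measurable (F j) := fun j =>
    (measurable_const.indicator (hA j)).comp (hsh j)
  have hFh : ∀ j, Homog0 (F j) := by
    intro j c hc f
    have := hAs j c hc (shift (-j) f)
    simp only [F, Set.indicator_apply]
    exact if_congr this rfl rfl
  have key : ∀ j, Q {ω | FirstMaxAtZeroE (fun t => (Θ ω t : ℝ≥0∞) / x (t + j))}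
      = ∫⁻ ω, (Z ω j : ℝ≥0∞) * F j (Z ω) ∂P := by
    intro j
    rw [hZ.tilt_shift j (F j) (hF j) (hFh j)]
    refine (hΘ.2 (A j) (hA j)).trans (lintegral_congr fun ω => ?_)
    by_cases h0 : Z ω 0 = 0
    · simp [h0]
    congr 1
    have e : shift (-j) (shift j (Z ω)) = Z ω := by
      funext t; simp [shift]
    simp only [F, e, Set.indicator_apply]
    refine if_congr ?_ rfl rfl
    have := hAs j (Z ω 0)⁻¹ (by positivity) (Z ω)
    simpa only [div_eq_inv_mul] using this
  have hpt : ∀ ω, ⨆ t : Idx d, (Z ω t : ℝ≥0∞) / x t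
      = ∑' j, (x j)⁻¹ * ((Z ω j : ℝ≥0∞) * F j (Z ω)) := by
    intro ω
    rw [aux_pointwise (fun t => (Z ω t : ℝ≥0∞) / x t)
      (fun t => ENNReal.div_ne_top ENNReal.coe_ne_top (hxpos t).ne')
      (hfin.subset fun t ht h => ht (by simp [h]))]
    refine tsum_congr fun j => ?_
    rw [← mul_assoc, div_eq_mul_inv, mul_comm (x j)⁻¹]
    congr 1
    simp [F, A, Set.indicator_apply, shift]
  simp_rw [hpt, key]
  have hm : ∀ j, Measurable fun ω => (Z ω j : ℝ≥0∞) * F j (Z ω) := fun j =>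
    (hZt j).mul ((hF j).comp hZ.meas)
  rw [lintegral_tsum fun j => ((hm j).const_mul _).aemeasurable]
  exact tsum_congr fun j => lintegral_const_mul _ (hm j)
end

section
/- Let V(t), t ∈ ℤ^d, be a random field with nonnegative values and fix a norm ‖·‖ on ℝ^d. Then P( V(t) → 0 as ‖t‖ → ∞ ) = 1 if and only if there exists a non-decreasing sequence of positive integers r_n with r_n → ∞ such that for every δ > 0: lim_{m→∞} limsup_{n→∞} P( max_{t∈ℤ^d, m ≤ ‖t‖ ≤ r_n} V(t) > δ ) = 0. -/
open MeasureTheory ENNReal Filter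
open scoped NNReal ENNReal

/-- The (sup-)norm of `t ∈ ℤ^d`, viewed in `ℝ^d`. -/
noncomputable def znorm {d : ℕ} (t : Idx d) : ℝ := ‖(fun j => (t j : ℝ) : Fin d → ℝ)‖

/-- The event that `V` exceeds `δ` somewhere at distance at least `m`. -/
def farEvent {d : ℕ} {Ω : Type*} (V : Ω → Idx d → ℝ≥0) (δ : ℝ) (m : ℕ) : Set Ω :=
  {ω | ∃ t : Idx d, (m : ℝ) ≤ znorm t ∧ δ < (V ω t : ℝ)}

lemma farEvent_meas {d : ℕ} {Ω : Type*} [MeasurableSpace Ω] (V : Ω → Idx d → ℝ≥0)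
    (hVmeas : ∀ t, Measurable fun ω => V ω t) (δ : ℝ) (m : ℕ) :
    MeasurableSet (farEvent V δ m) := by
  have : farEvent V δ m = ⋃ t : Idx d, {ω | (m : ℝ) ≤ znorm t ∧ δ < (V ω t : ℝ)} := by
    ext ω; simp [farEvent]
  rw [this]
  refine MeasurableSet.iUnion fun t => ?_
  refine MeasurableSet.inter (MeasurableSet.const _) ?_
  exact measurableSet_lt measurable_const (hVmeas t).coe_nnreal_real

lemma limsup_eq_far {d : ℕ} {Ω : Type*} [MeasurableSpace Ω] (P : Measure Ω)
    (V : Ω → Idx d → ℝ≥0) (r : ℕ → ℕ) (hr : Monotone r) (hr' : Tendsto r atTop atTop)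
    (δ : ℝ) (m : ℕ) :
    Filter.limsup (fun n : ℕ =>
      P {ω | ∃ t : Idx d, (m : ℝ) ≤ znorm t ∧ znorm t ≤ (r n : ℝ) ∧ δ < (V ω t : ℝ)}) atTop
      = P (farEvent V δ m) := by
  have hU : farEvent V δ m = ⋃ n, {ω | ∃ t : Idx d, (m : ℝ) ≤ znorm t ∧
      znorm t ≤ (r n : ℝ) ∧ δ < (V ω t : ℝ)} := by
    ext ω
    simp only [farEvent, Set.mem_setOf_eq, Set.mem_iUnion]
    constructor
    · rintro ⟨t, h1, h2⟩
      obtain ⟨k, hk⟩ := exists_nat_ge (znorm t)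
      obtain ⟨n, hn⟩ := (hr'.eventually_ge_atTop k).exists
      exact ⟨n, t, h1, hk.trans (by exact_mod_cast hn), h2⟩
    · rintro ⟨n, t, h1, -, h2⟩
      exact ⟨t, h1, h2⟩
  rw [hU]
  refine Tendsto.limsup_eq (tendsto_measure_iUnion_atTop ?_)
  rintro a b hab ω ⟨t, h1, h2, h3⟩
  exact ⟨t, h1, h2.trans (by exact_mod_cast hr hab), h3⟩

lemma tendsto_far {d : ℕ} {Ω : Type*} [MeasurableSpace Ω] (P : Measure Ω)
    [IsProbabilityMeasure P] (V : Ω → Idx d → ℝ≥0)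
    (hVmeas : ∀ t, Measurable fun ω => V ω t) (δ : ℝ) :
    Tendsto (fun m => P (farEvent V δ m)) atTop (nhds (P (⋂ m, farEvent V δ m))) := by
  refine tendsto_measure_iInter_atTop
    (fun m => (farEvent_meas V hVmeas δ m).nullMeasurableSet) ?_ ⟨0, measure_ne_top _ _⟩
  rintro a b hab ω ⟨t, h1, h2⟩
  exact ⟨t, le_trans (by exact_mod_cast hab) h1, h2⟩

lemma conv_iff {d : ℕ} {Ω : Type*} (V : Ω → Idx d → ℝ≥0) (ω : Ω) :
    Tendsto (fun t : Idx d => (V ω t : ℝ)) (Filter.comap znorm atTop) (nhds 0) ↔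
      ∀ δ : ℝ, 0 < δ → ω ∉ ⋂ m, farEvent V δ m := by
  have hb : (Filter.comap (znorm (d := d)) atTop).HasBasis (fun _ : ℝ => True)
      (fun a => znorm ⁻¹' Set.Ici a) := atTop_basis.comap _
  rw [hb.tendsto_iff Metric.nhds_basis_closedBall]
  refine forall₂_congr fun δ hδ => ?_
  simp only [Set.mem_iInter, not_forall, farEvent, Set.mem_setOf_eq, not_exists, not_and, not_lt,
    true_and, Set.mem_preimage, Set.mem_Ici, Metric.mem_closedBall, Real.dist_eq, sub_zero,
    NNReal.abs_eq]
  constructor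
  · rintro ⟨a, ha⟩
    obtain ⟨k, hk⟩ := exists_nat_ge a
    exact ⟨k, fun t ht => ha t (hk.trans ht)⟩
  · rintro ⟨k, hk⟩
    exact ⟨k, hk⟩

lemma conv_iff_nat {d : ℕ} {Ω : Type*} (V : Ω → Idx d → ℝ≥0) (ω : Ω) :
    Tendsto (fun t : Idx d => (V ω t : ℝ)) (Filter.comap znorm atTop) (nhds 0) ↔
      ∀ k : ℕ, ω ∉ ⋂ m, farEvent V (1 / ((k : ℝ) + 1)) m := by
  rw [conv_iff]
  constructor
  · intro h k
    exact h _ (by positivity)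
  · intro h δ hδ hω
    obtain ⟨k, hk⟩ := exists_nat_one_div_lt hδ
    refine h k (Set.mem_iInter.2 fun m => ?_)
    obtain ⟨t, h1, h2⟩ := Set.mem_iInter.1 hω m
    exact ⟨t, h1, hk.trans h2⟩

lemma conv_meas {d : ℕ} {Ω : Type*} [MeasurableSpace Ω] (V : Ω → Idx d → ℝ≥0)
    (hVmeas : ∀ t, Measurable fun ω => V ω t) :
    MeasurableSet {ω | Tendsto (fun t : Idx d => (V ω t : ℝ))
      (Filter.comap znorm atTop) (nhds 0)} := by
  simp only [conv_iff_nat, Set.setOf_forall]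
  exact MeasurableSet.iInter fun k =>
    (MeasurableSet.iInter fun m => farEvent_meas V hVmeas _ m).compl

/-- For a nonnegative random field `V` on `ℤ^d`,
`P(V(t) → 0 as ‖t‖ → ∞) = 1` iff there exists a non-decreasing sequence of positive
integers `r_n → ∞` such that for every `δ > 0`,
`lim_{m→∞} limsup_{n→∞} P(max_{m ≤ ‖t‖ ≤ r_n} V(t) > δ) = 0`. -/
theorem stmt17 {d : ℕ} (hd : 0 < d) {Ω : Type*} [MeasurableSpace Ω] (P : Measure Ω)
    [IsProbabilityMeasure P] (V : Ω → Idx d → ℝ≥0)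
    (hVmeas : ∀ t, Measurable fun ω => V ω t) :
    (P {ω | Tendsto (fun t : Idx d => (V ω t : ℝ)) (Filter.comap znorm atTop) (nhds 0)}
        = 1) ↔
      (∃ r : ℕ → ℕ, Monotone r ∧ (∀ n, 0 < r n) ∧ Tendsto r atTop atTop ∧
        ∀ δ : ℝ, 0 < δ →
          Tendsto
            (fun m : ℕ =>
              Filter.limsup
                (fun n : ℕ =>
                  P {ω | ∃ t : Idx d, (m : ℝ) ≤ znorm t ∧ znorm t ≤ (r n : ℝ) ∧
                    δ < (V ω t : ℝ)})
                atTop)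
            atTop (nhds 0)) := by
  rw [← mem_ae_iff_prob_eq_one (conv_meas V hVmeas)]
  constructor
  · intro h
    refine ⟨fun n => n + 1, fun a b hab => Nat.succ_le_succ hab, fun n => Nat.succ_pos n,
      tendsto_add_atTop_nat 1, fun δ hδ => ?_⟩
    have h0 : P (⋂ m, farEvent V δ m) = 0 := by
      refine measure_mono_null (t := {ω | Tendsto (fun t : Idx d => (V ω t : ℝ))
        (Filter.comap znorm atTop) (nhds 0)}ᶜ) (fun ω hω hc => ?_) h
      exact (conv_iff V ω).1 hc δ hδ hω
    have := tendsto_far P V hVmeas δ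
    rw [h0] at this
    refine this.congr fun m => ?_
    exact (limsup_eq_far P V (fun n => n + 1) (fun a b hab => Nat.succ_le_succ hab)
      (tendsto_add_atTop_nat 1) δ m).symm
  · rintro ⟨r, hr, -, hr', h⟩
    have h0 : ∀ δ : ℝ, 0 < δ → P (⋂ m, farEvent V δ m) = 0 := by
      intro δ hδ
      have h1 := h δ hδ
      simp only [limsup_eq_far P V r hr hr'] at h1
      exact tendsto_nhds_unique (tendsto_far P V hVmeas δ) h1
    have h2 : ∀ᵐ ω ∂P, ∀ k : ℕ, ω ∉ ⋂ m, farEvent V (1 / ((k : ℝ) + 1)) m :=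
      ae_all_iff.2 fun k => measure_eq_zero_iff_ae_notMem.1 (h0 _ (by positivity))
    filter_upwards [h2] with ω hω
    exact (conv_iff_nat V ω).2 hω
end

section
/- Let η₁ and η₂ be independent random fields on ℤ^d with unit Fréchet marginal distributions (P(η_i(t) ≤ x) = exp(−1/x), x > 0), and suppose their extremal indices exist: there are θ₁, θ₂ ∈ [0,1] such that for every x > 0 and i = 1, 2, lim_{n→∞} P( max_{t∈{0,…,n}^d} η_i(t) ≤ n^d x ) = exp(−θ_i/x). Then for every p ∈ (0,1) the field X(t) = max(p·η₁(t), (1−p)·η₂(t)) satisfies, for every x > 0, lim_{n→∞} P( max_{t∈{0,…,n}^d} X(t) ≤ n^d x ) = exp( −(p·θ₁ + (1−p)·θ₂)/x ); that is, X has extremal index p·θ₁ + (1−p)·θ₂ ∈ [0,1]. -/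
open MeasureTheory ENNReal Filter
open scoped NNReal ENNReal

/-- Let `η₁, η₂` be independent random fields on `ℤ^d` with unit
Fréchet marginals whose extremal indices `θ₁, θ₂ ∈ [0,1]` exist:
`P(max_{t∈{0,…,n}^d} ηᵢ(t) ≤ n^d x) → exp(-θᵢ/x)` for every `x > 0`.  Then for every
`p ∈ (0,1)` the field `X(t) = max(p·η₁(t), (1-p)·η₂(t))` has extremal index
`p·θ₁ + (1-p)·θ₂`:  `P(max_{t∈{0,…,n}^d} X(t) ≤ n^d x) → exp(-(p θ₁ + (1-p) θ₂)/x)`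
for every `x > 0`. -/
theorem stmt18 {d : ℕ} (hd : 0 < d) {Ω : Type*} [MeasurableSpace Ω] (P : Measure Ω)
    [IsProbabilityMeasure P] (η₁ η₂ : Ω → Idx d → ℝ)
    (hmeas₁ : Measurable η₁) (hmeas₂ : Measurable η₂)
    (hind : ProbabilityTheory.IndepFun η₁ η₂ P)
    (hfrechet₁ : ∀ (t : Idx d) (x : ℝ), 0 < x →
      P {ω | η₁ ω t ≤ x} = ENNReal.ofReal (Real.exp (-x⁻¹)))
    (hfrechet₂ : ∀ (t : Idx d) (x : ℝ), 0 < x →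
      P {ω | η₂ ω t ≤ x} = ENNReal.ofReal (Real.exp (-x⁻¹)))
    (θ₁ θ₂ : ℝ) (hθ₁01 : θ₁ ∈ Set.Icc (0:ℝ) 1) (hθ₂01 : θ₂ ∈ Set.Icc (0:ℝ) 1)
    (hθ₁ : ∀ x : ℝ, 0 < x →
      Tendsto (fun n : ℕ => P {ω | ∀ t ∈ cube d n, η₁ ω t ≤ (n : ℝ) ^ d * x}) atTop
        (nhds (ENNReal.ofReal (Real.exp (-(θ₁ / x))))))
    (hθ₂ : ∀ x : ℝ, 0 < x →
      Tendsto (fun n : ℕ => P {ω | ∀ t ∈ cube d n, η₂ ω t ≤ (n : ℝ) ^ d * x}) atTop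
        (nhds (ENNReal.ofReal (Real.exp (-(θ₂ / x))))))
    (p : ℝ) (hp : 0 < p) (hp1 : p < 1) :
    (0 ≤ p * θ₁ + (1 - p) * θ₂ ∧ p * θ₁ + (1 - p) * θ₂ ≤ 1) ∧
    ∀ x : ℝ, 0 < x →
      Tendsto
        (fun n : ℕ =>
          P {ω | ∀ t ∈ cube d n, max (p * η₁ ω t) ((1 - p) * η₂ ω t) ≤ (n : ℝ) ^ d * x})
        atTop
        (nhds (ENNReal.ofReal (Real.exp (-((p * θ₁ + (1 - p) * θ₂) / x))))) := by
  obtain ⟨a1, b1⟩ := hθ₁01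
  obtain ⟨a2, b2⟩ := hθ₂01
  have hq : 0 < 1 - p := by linarith
  refine ⟨⟨by positivity, by nlinarith⟩, ?_⟩
  intro x hx
  have key : ∀ n : ℕ,
      P {ω | ∀ t ∈ cube d n, max (p * η₁ ω t) ((1 - p) * η₂ ω t) ≤ (n : ℝ) ^ d * x} =
      P {ω | ∀ t ∈ cube d n, η₁ ω t ≤ (n : ℝ) ^ d * (x / p)} *
      P {ω | ∀ t ∈ cube d n, η₂ ω t ≤ (n : ℝ) ^ d * (x / (1 - p))} := by
    intro n
    have hm : ∀ c : ℝ, MeasurableSet {f : Idx d → ℝ | ∀ t ∈ cube d n, f t ≤ c} := by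
      intro c
      have : {f : Idx d → ℝ | ∀ t ∈ cube d n, f t ≤ c} =
          ⋂ t ∈ cube d n, {f : Idx d → ℝ | f t ≤ c} := by
        ext f; simp
      rw [this]
      exact MeasurableSet.biInter (Set.to_countable _) fun t _ =>
        measurableSet_le (measurable_pi_apply t) measurable_const
    have h := hind.measure_inter_preimage_eq_mul _ _ (hm ((n : ℝ) ^ d * (x / p)))
      (hm ((n : ℝ) ^ d * (x / (1 - p))))
    have e : {ω | ∀ t ∈ cube d n, max (p * η₁ ω t) ((1 - p) * η₂ ω t) ≤ (n : ℝ) ^ d * x} =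
        η₁ ⁻¹' {f : Idx d → ℝ | ∀ t ∈ cube d n, f t ≤ (n : ℝ) ^ d * (x / p)} ∩
        η₂ ⁻¹' {f : Idx d → ℝ | ∀ t ∈ cube d n, f t ≤ (n : ℝ) ^ d * (x / (1 - p))} := by
      ext ω
      simp only [Set.mem_setOf_eq, Set.mem_inter_iff, Set.mem_preimage, max_le_iff,
        ← mul_div_assoc, le_div_iff₀ hp, le_div_iff₀ hq, mul_comm p, mul_comm (1 - p)]
      exact ⟨fun h => ⟨fun t ht => (h t ht).1, fun t ht => (h t ht).2⟩,
        fun h t ht => ⟨h.1 t ht, h.2 t ht⟩⟩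
    rw [e, h]
    rfl
  have hlim : ENNReal.ofReal (Real.exp (-((p * θ₁ + (1 - p) * θ₂) / x))) =
      ENNReal.ofReal (Real.exp (-(θ₁ / (x / p)))) *
      ENNReal.ofReal (Real.exp (-(θ₂ / (x / (1 - p))))) := by
    rw [← ENNReal.ofReal_mul (Real.exp_pos _).le, ← Real.exp_add]
    congr 2
    field_simp
    ring
  simp_rw [key]
  rw [hlim]
  exact ENNReal.Tendsto.mul (hθ₁ _ (div_pos hx hp)) (Or.inr ENNReal.ofReal_ne_top)
    (hθ₂ _ (div_pos hx hq)) (Or.inr ENNReal.ofReal_ne_top)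
end

section
/- Let c : ℤ^d → [0,∞) with C = Σ_{i∈ℤ^d} c_i^α ∈ (0,∞) for some α > 0, let S be a ℤ^d-valued random variable with P(S = i) = c_i^α/C, and define the random field Θ(i) = c_{i+S}/c_S, i ∈ ℤ^d (well defined almost surely since c_S > 0 a.s.). Then Θ(0) = 1 almost surely; for every h ∈ ℤ^d and every measurable 0-homogeneous F : E → [0,∞], E[Θ(h)^α F(Θ)] = E[F(B^h Θ)·1{Θ(−h) ≠ 0}]; and E[ max_{t∈ℤ^d} Θ(t)^α / Σ_{t∈ℤ^d} Θ(t)^α ] = (max_{t∈ℤ^d} c_t^α)/C. -/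
open MeasureTheory ENNReal Filter
open scoped NNReal ENNReal

/-- Let `c : ℤ^d → [0,∞)` with `C = Σ_i c_i^α ∈ (0,∞)`, let `S` be a
`ℤ^d`-valued random variable with `P(S = i) = c_i^α / C`, and `Θ(i) = c_{i+S}/c_S`.
Then `Θ(0) = 1` a.s.; `Θ` satisfies the `α`-version of the tilt-shift identity
`E[Θ(h)^α F(Θ)] = E[F(B^h Θ) 1{Θ(-h) ≠ 0}]` for every measurable 0-homogeneous `F`;
and `E[max_t Θ(t)^α / Σ_t Θ(t)^α] = (max_t c_t^α)/C`. -/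
theorem stmt19 {d : ℕ} (hd : 0 < d) {Ω : Type*} [MeasurableSpace Ω] (P : Measure Ω)
    [IsProbabilityMeasure P] (c : Idx d → ℝ≥0) (α : ℝ) (hα : 0 < α)
    (hCpos : 0 < ∑' i : Idx d, (c i : ℝ≥0∞) ^ α)
    (hCfin : (∑' i : Idx d, (c i : ℝ≥0∞) ^ α) < ∞)
    (S : Ω → Idx d) (hSmeas : Measurable S)
    (hSlaw : ∀ i : Idx d,
      P {ω | S ω = i} = (c i : ℝ≥0∞) ^ α / ∑' i' : Idx d, (c i' : ℝ≥0∞) ^ α) :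
    (∀ᵐ ω ∂P, c (0 + S ω) / c (S ω) = 1) ∧
    (∀ (h : Idx d) (F : Fld d → ℝ≥0∞), Measurable F → Homog0 F →
      ∫⁻ ω, ((c (h + S ω) / c (S ω) : ℝ≥0) : ℝ≥0∞) ^ α *
          F (fun i => c (i + S ω) / c (S ω)) ∂P =
        ∫⁻ ω in {ω | c (-h + S ω) / c (S ω) ≠ 0},
          F (shift h (fun i => c (i + S ω) / c (S ω))) ∂P) ∧
    (∫⁻ ω, (⨆ t : Idx d, ((c (t + S ω) / c (S ω) : ℝ≥0) : ℝ≥0∞) ^ α) /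
        (∑' t : Idx d, ((c (t + S ω) / c (S ω) : ℝ≥0) : ℝ≥0∞) ^ α) ∂P =
      (⨆ t : Idx d, (c t : ℝ≥0∞) ^ α) / ∑' i : Idx d, (c i : ℝ≥0∞) ^ α) := by
  set C := ∑' i : Idx d, (c i : ℝ≥0∞) ^ α with hC
  have hae : ∀ᵐ ω ∂P, c (S ω) ≠ 0 := by
    have h1 : ∀ i : Idx d, ∀ᵐ ω ∂P, S ω = i → c i ≠ 0 := by
      intro i
      by_cases hi : c i = 0
      · have h0 : P {ω | S ω = i} = 0 := by
          rw [hSlaw i, hi]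
          simp [hα]
        rw [ae_iff]
        refine measure_mono_null ?_ h0
        intro ω hω
        simp only [Set.mem_ofPred_eq, Classical.not_imp] at hω
        exact hω.1
      · exact Eventually.of_forall fun ω _ => hi
    filter_upwards [ae_all_iff.2 h1] with ω hω
    exact hω _ rfl
  have key : ∀ G : Idx d → ℝ≥0∞, ∫⁻ ω, G (S ω) ∂P = ∑' i, G i * ((c i : ℝ≥0∞) ^ α / C) := by
    intro G
    have hG : Measurable G := Measurable.of_discrete
    rw [← lintegral_map hG hSmeas, lintegral_countable']
    refine tsum_congr fun i => ?_
    rw [Measure.map_apply hSmeas (measurableSet_singleton i), ← hSlaw i]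
    rfl
  refine ⟨?_, ?_, ?_⟩
  · filter_upwards [hae] with ω hω
    rw [zero_add, div_self hω]
  · intro h F _ hF
    have hFd : ∀ (k : ℝ≥0), k ≠ 0 → ∀ f : Fld d, F (fun t => f t / k) = F f := by
      intro k hk f
      rw [← hF k⁻¹ (by positivity) f]
      congr 1
      funext t
      rw [div_eq_mul_inv, mul_comm]
    have hms : MeasurableSet {ω | c (-h + S ω) / c (S ω) ≠ 0} :=
      hSmeas (MeasurableSet.of_discrete (s := {i : Idx d | c (-h + i) / c i ≠ 0}))
    rw [← lintegral_indicator hms]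
    rw [key (fun s => ((c (h + s) / c s : ℝ≥0) : ℝ≥0∞) ^ α * F (fun i => c (i + s) / c s))]
    have e := key (fun s => Set.indicator {i : Idx d | c (-h + i) / c i ≠ 0}
      (fun s => F (shift h (fun i => c (i + s) / c s))) s)
    refine Eq.trans ?_ e.symm
    refine Eq.trans ?_ ((Equiv.addLeft h).tsum_eq _)
    refine tsum_congr fun s => ?_
    simp only [Equiv.coe_addLeft, Set.indicator, Set.mem_ofPred_eq, neg_add_cancel_left]
    by_cases hs : c s = 0
    · simp [hs, hα]
    by_cases hs' : c (h + s) = 0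
    · simp [hs', hα]
    have e1 : shift h (fun i => c (i + (h + s)) / c (h + s)) = fun i => c (i + s) / c (h + s) := by
      funext i
      change c (i - h + (h + s)) / c (h + s) = _
      congr 2
      abel
    rw [if_pos (div_ne_zero hs hs'), e1, hFd _ hs (fun i => c (i + s)),
      hFd _ hs' (fun i => c (i + s)), ENNReal.coe_div hs, ENNReal.div_rpow_of_nonneg _ _ hα.le]
    have hk0 : (c s : ℝ≥0∞) ^ α ≠ 0 := by simp [hs, hα.le]
    have hkt : (c s : ℝ≥0∞) ^ α ≠ ∞ := by simp [hα.le]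
    rw [mul_comm (_ / _) (F _), mul_assoc, ← mul_div_assoc, ENNReal.div_mul_cancel hk0 hkt]
  · have : ∀ᵐ ω ∂P, (⨆ t : Idx d, ((c (t + S ω) / c (S ω) : ℝ≥0) : ℝ≥0∞) ^ α) /
        (∑' t : Idx d, ((c (t + S ω) / c (S ω) : ℝ≥0) : ℝ≥0∞) ^ α) =
        (⨆ t : Idx d, (c t : ℝ≥0∞) ^ α) / C := by
      filter_upwards [hae] with ω hs
      have hk0 : (c (S ω) : ℝ≥0∞) ^ α ≠ 0 := by simp [hs, hα.le]
      have hkt : (c (S ω) : ℝ≥0∞) ^ α ≠ ∞ := by simp [hα.le]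
      simp only [ENNReal.coe_div hs, ENNReal.div_rpow_of_nonneg _ _ hα.le, div_eq_mul_inv (_ ^ α)]
      rw [ENNReal.tsum_mul_right, ← ENNReal.iSup_mul,
        ENNReal.mul_div_mul_right _ _ (ENNReal.inv_ne_zero.2 hkt) (ENNReal.inv_ne_top.2 hk0)]
      congr 1
      · exact (Equiv.addRight (S ω)).iSup_comp (g := fun t => (c t : ℝ≥0∞) ^ α)
      · exact (Equiv.addRight (S ω)).tsum_eq (fun t => (c t : ℝ≥0∞) ^ α)
    rw [lintegral_congr_ae this]
    simp
end
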